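/- arXiv:2512.16772 — 2 statements merged into one kernel-verified Lean document; each statement's English description precedes it below -/
import Mathlib

section
/- Let α, β, γ ∈ ℝ satisfy α > 0 and α(α + γ) − β² > 0. Then the partition function integral of the Souriau Gibbs state on the Poincaré plane converges and has the closed form ∫_ℝ ∫_ℝ exp(−(1/2) e^{−2x} (α + γ + α e^{4x}(y² + 1) + 2β e^{2x} y)) dy dx = π · e^{−√(α(α+γ) − β²)} / √(α(α+γ) − β²). -/
open MeasureTheory

lemma aux_cv (a b : ℝ) (ha : 0 < a) (hb : 0 < b) :
    Integrable (fun x : ℝ => (a * Real.exp x + b * Real.exp (-x)) *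
      Real.exp (-(1/2) * (a * Real.exp x - b * Real.exp (-x))^2)) ∧
    ∫ x : ℝ, (a * Real.exp x + b * Real.exp (-x)) *
      Real.exp (-(1/2) * (a * Real.exp x - b * Real.exp (-x))^2) = √(2 * Real.pi) := by
  have hd : ∀ x ∈ (Set.univ : Set ℝ), HasDerivWithinAt
      (fun x : ℝ => a * Real.exp x - b * Real.exp (-x))
      (a * Real.exp x + b * Real.exp (-x)) Set.univ x := by
    intro x _
    have h1 := (Real.hasDerivAt_exp x).const_mul a
    have h2 := ((hasDerivAt_neg x).exp).const_mul b
    have h3 := h1.sub h2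
    refine HasDerivAt.hasDerivWithinAt ?_
    convert h3 using 1
    · rfl
    · ring
  have hinj : Set.InjOn (fun x : ℝ => a * Real.exp x - b * Real.exp (-x)) Set.univ := by
    apply Function.Injective.injOn
    apply StrictMono.injective
    intro x y hxy
    have h1 := Real.exp_lt_exp.2 hxy
    have h2 := Real.exp_lt_exp.2 (neg_lt_neg hxy)
    have h3 := mul_lt_mul_of_pos_left h1 ha
    have h4 := mul_lt_mul_of_pos_left h2 hb
    simp only
    linarith
  have hsurj : Function.Surjective (fun x : ℝ => a * Real.exp x - b * Real.exp (-x)) := by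
    apply Continuous.surjective (by fun_prop)
    · simp only [sub_eq_add_neg]
      refine Filter.tendsto_atTop_add_right_of_le' _ (-b)
        (Real.tendsto_exp_atTop.const_mul_atTop ha) ?_
      filter_upwards [Filter.eventually_ge_atTop 0] with x hx
      have : Real.exp (-x) ≤ 1 := Real.exp_le_one_iff.2 (by linarith)
      nlinarith
    · simp only [sub_eq_add_neg]
      refine Filter.tendsto_atBot_add_left_of_ge' _ a ?_ ?_
      · filter_upwards [Filter.eventually_le_atBot 0] with x hx
        have : Real.exp x ≤ 1 := Real.exp_le_one_iff.2 (by linarith)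
        nlinarith
      · exact Filter.tendsto_neg_atTop_atBot.comp
          ((Real.tendsto_exp_atTop.comp Filter.tendsto_neg_atBot_atTop).const_mul_atTop hb)
  have him : (fun x : ℝ => a * Real.exp x - b * Real.exp (-x)) '' Set.univ = Set.univ := by
    rw [Set.image_univ, hsurj.range_eq]
  have hpos : ∀ x : ℝ, |a * Real.exp x + b * Real.exp (-x)| = a * Real.exp x + b * Real.exp (-x) :=
    fun x => abs_of_pos (by positivity)
  have e1 := integrableOn_image_iff_integrableOn_abs_deriv_smul MeasurableSet.univ hd hinj
    (fun u => Real.exp (-(1/2) * u^2))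
  have e2 := integral_image_eq_integral_abs_deriv_smul MeasurableSet.univ hd hinj
    (fun u => Real.exp (-(1/2) * u^2))
  simp only [him, hpos, integrableOn_univ, setIntegral_univ, smul_eq_mul] at e1 e2
  refine ⟨e1.1 (integrable_exp_neg_mul_sq (by norm_num)), ?_⟩
  rw [← e2, integral_gaussian]
  congr 1
  ring

lemma aux_half (a b : ℝ) (ha : 0 < a) (hb : 0 < b) :
    Integrable (fun x : ℝ => Real.exp (-x) *
      Real.exp (-(1/2) * (a * Real.exp x - b * Real.exp (-x))^2)) ∧
    ∫ x : ℝ, Real.exp (-x) *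
      Real.exp (-(1/2) * (a * Real.exp x - b * Real.exp (-x))^2) = √(2 * Real.pi) / (2 * b) := by
  obtain ⟨hi, hv⟩ := aux_cv a b ha hb
  set F : ℝ → ℝ := fun x => Real.exp (-x) *
      Real.exp (-(1/2) * (a * Real.exp x - b * Real.exp (-x))^2) with hF
  have hFi : Integrable F := by
    refine (hi.const_mul b⁻¹).mono' (by apply Continuous.aestronglyMeasurable; fun_prop) ?_
    filter_upwards with x
    rw [Real.norm_of_nonneg (by positivity), ← mul_assoc]
    simp only [hF]
    gcongr
    rw [mul_add, inv_mul_cancel_left₀ hb.ne']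
    have : 0 ≤ b⁻¹ * (a * Real.exp x) := by positivity
    linarith
  refine ⟨hFi, ?_⟩
  have hsym : ∀ x, (a * Real.exp x + b * Real.exp (-x)) *
      Real.exp (-(1/2) * (a * Real.exp x - b * Real.exp (-x))^2)
      = b * F (Real.log (b/a) - x) + b * F x := by
    intro x
    have h1 : Real.exp (Real.log (b/a) - x) = b / a * Real.exp (-x) := by
      rw [sub_eq_add_neg, Real.exp_add, Real.exp_log (by positivity)]
    have h2 : Real.exp (-(Real.log (b/a) - x)) = a / b * Real.exp x := by
      rw [neg_sub, sub_eq_add_neg, add_comm, Real.exp_add, Real.exp_neg,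
        Real.exp_log (by positivity), inv_div]
    simp only [hF]
    rw [h1, h2]
    have h3 : a * (b / a * Real.exp (-x)) = b * Real.exp (-x) := by field_simp
    have h4 : b * (a / b * Real.exp x) = a * Real.exp x := by field_simp
    rw [h3, h4, ← mul_assoc, h4]
    rw [show (b * Real.exp (-x) - a * Real.exp x)^2 = (a * Real.exp x - b * Real.exp (-x))^2 by ring]
    ring
  simp_rw [hsym] at hv
  rw [integral_add ((hFi.comp_sub_left _).const_mul b) (hFi.const_mul b), integral_const_mul,
    integral_const_mul, integral_sub_left_eq_self F volume] at hv
  rw [eq_div_iff (by positivity)]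
  linarith

/-- Convergence and closed form of the Souriau partition function of the Poincaré plane: for
`α > 0` and `α(α+γ) − β² > 0`,
`∫∫ exp(−½ e^{−2x}(α + γ + α e^{4x}(y²+1) + 2β e^{2x} y)) dy dx
  = π e^{−√(α(α+γ)−β²)} / √(α(α+γ)−β²)`. -/
theorem stmt_7 (α β γ : ℝ) (hα : 0 < α) (hD : 0 < α * (α + γ) - β^2) :
    Integrable (fun p : ℝ × ℝ => Real.exp (-(1/2) * Real.exp (-2*p.1) *
      (α + γ + α * Real.exp (4*p.1) * (p.2^2 + 1) + 2*β*Real.exp (2*p.1)*p.2))) volume ∧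
    (∫ x : ℝ, ∫ y : ℝ, Real.exp (-(1/2) * Real.exp (-2*x) *
        (α + γ + α * Real.exp (4*x) * (y^2 + 1) + 2*β*Real.exp (2*x)*y)))
      = Real.pi * Real.exp (-Real.sqrt (α * (α + γ) - β^2))
          / Real.sqrt (α * (α + γ) - β^2) := by
  set s := √(α * (α + γ) - β^2) with hs
  have hs0 : 0 < s := Real.sqrt_pos.2 hD
  have hs2 : s^2 = α * (α + γ) - β^2 := Real.sq_sqrt hD.le
  have hr0 : 0 < √α := Real.sqrt_pos.2 hα
  have hr2 : √α ^ 2 = α := Real.sq_sqrt hα.le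
  obtain ⟨hi, hv⟩ := aux_half (√α) (s / √α) hr0 (by positivity)
  -- complete the squares
  have key : ∀ x y : ℝ, Real.exp (-(1/2) * Real.exp (-2*x) *
        (α + γ + α * Real.exp (4*x) * (y^2 + 1) + 2*β*Real.exp (2*x)*y))
      = (Real.exp (-s) * Real.exp (-(1/2) * (√α * Real.exp x - s / √α * Real.exp (-x))^2)) *
        Real.exp (-(α * Real.exp x ^ 2 / 2) * (y + β / α * Real.exp (-x) ^ 2)^2) := by
    intro x y
    rw [← Real.exp_add, ← Real.exp_add]
    congr 1
    have e1 : Real.exp (-2*x) = Real.exp (-x) ^ 2 := by rw [← Real.exp_nat_mul]; congr 1; push_cast; ring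
    have e2 : Real.exp (2*x) = Real.exp x ^ 2 := by rw [← Real.exp_nat_mul]; congr 1
    have e4 : Real.exp (4*x) = Real.exp x ^ 4 := by rw [← Real.exp_nat_mul]; congr 1
    rw [e1, e2, e4, Real.exp_neg]
    have ht : Real.exp x ≠ 0 := (Real.exp_pos x).ne'
    have h5 : (√α * Real.exp x - s / √α * (Real.exp x)⁻¹)^2
        = α * Real.exp x ^ 2 - 2 * s + (α * (α + γ) - β^2) / α * ((Real.exp x)⁻¹)^2 := by
      rw [← hs2]
      nth_rewrite 3 4 [← hr2]
      field_simp
      ring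
    rw [h5]
    field_simp
    ring
  have hc : ∀ x : ℝ, 0 < α * Real.exp x ^ 2 / 2 := fun x => by positivity
  have hy : ∀ x : ℝ, ∫ y : ℝ, Real.exp (-(1/2) * Real.exp (-2*x) *
        (α + γ + α * Real.exp (4*x) * (y^2 + 1) + 2*β*Real.exp (2*x)*y))
      = (Real.exp (-s) * (√(2 * Real.pi) / √α)) * (Real.exp (-x) *
         Real.exp (-(1/2) * (√α * Real.exp x - s / √α * Real.exp (-x))^2)) := by
    intro x
    simp_rw [key]
    rw [integral_const_mul, integral_add_right_eq_self
      (fun y => Real.exp (-(α * Real.exp x ^ 2 / 2) * y^2)), integral_gaussian]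
    have : √(Real.pi / (α * Real.exp x ^ 2 / 2)) = √(2 * Real.pi) / √α * Real.exp (-x) := by
      rw [show Real.pi / (α * Real.exp x ^ 2 / 2) = (2 * Real.pi) / α / Real.exp x ^ 2 by
        field_simp, Real.sqrt_div' _ (by positivity), Real.sqrt_sq (Real.exp_pos x).le,
        Real.sqrt_div' _ hα.le, Real.exp_neg]
      rfl
    rw [this]
    ring
  constructor
  · rw [Measure.volume_eq_prod, integrable_prod_iff
      (by apply Continuous.aestronglyMeasurable; fun_prop)]
    constructor
    · filter_upwards with x
      simp only [key]
      exact ((integrable_exp_neg_mul_sq (hc x)).comp_add_right _).const_mul _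
    · simp only [Real.norm_eq_abs, Real.abs_exp]
      simp_rw [hy]
      exact hi.const_mul _
  · simp_rw [hy]
    rw [integral_const_mul, hv]
    have : √(2 * Real.pi) ^ 2 = 2 * Real.pi := Real.sq_sqrt (by positivity)
    field_simp
    rw [this]
end

section
/- Fix λ, μ ∈ ℝ with λ − μ > 0 and λ + μ > 0. Define, for w = (w₁, w₂, w₃, w₄, w₅, w₆) ∈ ℝ⁶, ρ₁ = e^{w₁}, ρ₂ = e^{w₂}, Q₁(w) = (w₆² + 4) w₃² + 2√2 w₃ w₅ w₆ + 2(w₅² + 4), Q₂(w) = 8 w₄² − 4√2 w₄ w₅ w₆ + (w₅² + 4)(w₆² + 4), and the exponent E(w) = −[ ρ₁² ρ₂² Q₂(w)(λ − μ) + 2 ρ₁² Q₁(w)(λ + μ) + 4 ρ₂² (w₆² + 4)(λ + μ) + 16(λ − μ) ] / (64 ρ₁ ρ₂). Then the function w ↦ exp(E(w)) is Lebesgue integrable on ℝ⁶, i.e. the Souriau partition function of the Siegel half-plane 𝕊ℍ₂ at the Cartan temperature pair (λ, μ) converges. -/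
open MeasureTheory

/-- The quadratic expression `Q₁(w) = (w₆²+4)w₃² + 2√2 w₃w₅w₆ + 2(w₅²+4)` appearing in the
Siegel moment maps (coordinates `w₁,…,w₆ = w 0,…,w 5`). -/
noncomputable def Qone (w : EuclideanSpace ℝ (Fin 6)) : ℝ :=
  ((w 5)^2 + 4) * (w 2)^2 + 2 * Real.sqrt 2 * w 2 * w 4 * w 5 + 2 * ((w 4)^2 + 4)

/-- The quadratic expression `Q₂(w) = 8w₄² − 4√2 w₄w₅w₆ + (w₅²+4)(w₆²+4)`. -/
noncomputable def Qtwo (w : EuclideanSpace ℝ (Fin 6)) : ℝ :=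
  8 * (w 3)^2 - 4 * Real.sqrt 2 * w 3 * w 4 * w 5 + ((w 4)^2 + 4) * ((w 5)^2 + 4)

/-- The exponent of the Souriau Gibbs integrand of the Siegel half-plane `𝕊ℍ₂` at the Cartan
temperature pair `(λ, μ)`, with `ρ₁ = e^{w₁}`, `ρ₂ = e^{w₂}`. -/
noncomputable def siegelExp (l m : ℝ) (w : EuclideanSpace ℝ (Fin 6)) : ℝ :=
  -((Real.exp (w 0))^2 * (Real.exp (w 1))^2 * Qtwo w * (l - m)
      + 2 * (Real.exp (w 0))^2 * Qone w * (l + m)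
      + 4 * (Real.exp (w 1))^2 * ((w 5)^2 + 4) * (l + m)
      + 16 * (l - m))
    / (64 * Real.exp (w 0) * Real.exp (w 1))

lemma aux_lin (P t : ℝ) (hP : 0 < P) : |t| ≤ P * t ^ 2 + P⁻¹ := by
  have h : P * t ^ 2 + P⁻¹ - |t| = P * (|t| - P⁻¹ / 2) ^ 2 + 3 / 4 * P⁻¹ := by
    have : t ^ 2 = |t| ^ 2 := (sq_abs t).symm
    rw [this]
    field_simp
    ring
  have h2 : 0 ≤ P * (|t| - P⁻¹ / 2) ^ 2 + 3 / 4 * P⁻¹ := by positivity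
  linarith

lemma aux_exp (s : ℝ) : |s| ≤ Real.exp s + (Real.exp s)⁻¹ := by
  rw [← Real.exp_neg]
  have h1 := Real.add_one_le_exp s
  have h2 := Real.add_one_le_exp (-s)
  have h3 := Real.exp_pos s
  have h4 := Real.exp_pos (-s)
  exact abs_le.2 ⟨by linarith, by linarith⟩

lemma aux_sqrt (t : ℝ) : Real.sqrt |t| ≤ |t| + 1 := by
  have := Real.sq_sqrt (abs_nonneg t)
  nlinarith [sq_nonneg (Real.sqrt |t| - 1), Real.sqrt_nonneg |t|, abs_nonneg t]

lemma aux_shear (k p y z : ℝ) (hk : |k| ≤ 1) :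
    Real.sqrt |p| ≤ |p - k * y * z| + 1 + |y| + |z| := by
  apply Real.sqrt_le_iff.2
  refine ⟨by positivity, ?_⟩
  have h1 : |p| ≤ |p - k * y * z| + |k * y * z| := by
    have := abs_add_le (p - k * y * z) (k * y * z)
    simpa using this
  have h2 : |k * y * z| ≤ |y| * |z| := by
    rw [mul_assoc, abs_mul, abs_mul]
    exact mul_le_of_le_one_left (by positivity) hk
  have := abs_nonneg (p - k * y * z)
  have hy := abs_nonneg y
  have hz := abs_nonneg z
  nlinarith [mul_nonneg this hy, mul_nonneg this hz, mul_nonneg hy hz]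

lemma aux_int (c : ℝ) (hc : 0 < c) : Integrable (fun t : ℝ => Real.exp (-c * Real.sqrt |t|)) := by
  have hbound : ∀ t : ℝ, Real.exp (-c * Real.sqrt |t|) ≤ (1 + 24 / c ^ 4) * (1 + t ^ 2)⁻¹ := by
    intro t
    set s := Real.sqrt |t| with hs
    have hs0 : 0 ≤ s := Real.sqrt_nonneg _
    have hs4 : s ^ 4 = t ^ 2 := by
      have : s ^ 2 = |t| := Real.sq_sqrt (abs_nonneg t)
      calc s ^ 4 = (s ^ 2) ^ 2 := by ring
        _ = t ^ 2 := by rw [this, sq_abs]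
    have h1 : (c * s) ^ 4 / 24 ≤ Real.exp (c * s) := by
      have := Real.pow_div_factorial_le_exp (c * s) (by positivity) 4
      simpa [Nat.factorial] using this
    have h0 : 1 ≤ Real.exp (c * s) := Real.one_le_exp (by positivity)
    rw [neg_mul, Real.exp_neg, ← div_eq_mul_inv, inv_le_comm₀ (Real.exp_pos _) (by positivity),
      inv_div, div_le_iff₀ (by positivity)]
    have h3 : t ^ 2 ≤ Real.exp (c * s) * (24 / c ^ 4) := by
      rw [← hs4]
      have : s ^ 4 = ((c * s) ^ 4 / 24) * (24 / c ^ 4) := by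
        field_simp
      rw [this]
      gcongr
    linarith
  refine Integrable.mono' (integrable_inv_one_add_sq.const_mul (1 + 24 / c ^ 4)) ?_ ?_
  · exact (by fun_prop : Continuous (fun t : ℝ => Real.exp (-c * Real.sqrt |t|))).aestronglyMeasurable
  · filter_upwards with t
    rw [Real.norm_eq_abs, abs_of_pos (Real.exp_pos _)]
    exact hbound t

lemma aux_Qone (w : EuclideanSpace ℝ (Fin 6)) : 4 * (w 2) ^ 2 + 8 ≤ Qone w := by
  have h2 : Real.sqrt 2 ^ 2 = 2 := Real.sq_sqrt (by norm_num)
  have : Qone w = (Real.sqrt 2 * w 4 + w 2 * w 5) ^ 2 + 4 * (w 2) ^ 2 + 8 := by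
    unfold Qone
    linear_combination (-(w 4) ^ 2) * h2
  nlinarith [sq_nonneg (Real.sqrt 2 * w 4 + w 2 * w 5)]

lemma aux_Qtwo (w : EuclideanSpace ℝ (Fin 6)) :
    Qtwo w = 8 * (w 3 - Real.sqrt 2 / 4 * w 4 * w 5) ^ 2 + 4 * (w 4) ^ 2 + 4 * (w 5) ^ 2 + 16 := by
  have h2 : Real.sqrt 2 ^ 2 = 2 := Real.sq_sqrt (by norm_num)
  unfold Qtwo
  linear_combination (-(w 4) ^ 2 * (w 5) ^ 2 / 2) * h2

lemma aux_main (l m c : ℝ) (hc : 0 < c) (h₁ : c ≤ (l - m) / 64) (h₂ : c ≤ (l + m) / 64)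
    (w : EuclideanSpace ℝ (Fin 6)) :
    siegelExp l m w ≤ -c * (|w 0| + |w 1| + |w 2| + |w 3 - Real.sqrt 2 / 4 * w 4 * w 5|
      + |w 4| + |w 5|) := by
  set x := w 3 - Real.sqrt 2 / 4 * w 4 * w 5 with hx
  set P := Real.exp (w 0 + w 1) with hP
  set R := Real.exp (w 0 - w 1) with hR
  have hP0 : 0 < P := Real.exp_pos _
  have hR0 : 0 < R := Real.exp_pos _
  have hE : siegelExp l m w = -((l - m) / 64 * (P * Qtwo w + 16 * P⁻¹)
      + (l + m) / 64 * (2 * R * Qone w + 4 * ((w 5) ^ 2 + 4) * R⁻¹)) := by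
    unfold siegelExp
    rw [hP, hR, Real.exp_add, Real.exp_sub]
    have ha := Real.exp_pos (w 0)
    have hb := Real.exp_pos (w 1)
    field_simp
    ring
  have hPi : 0 < P⁻¹ := inv_pos.2 hP0
  have hRi : 0 < R⁻¹ := inv_pos.2 hR0
  have hA : |w 0 + w 1| + |x| + |w 4| + |w 5| ≤ P * Qtwo w + 16 * P⁻¹ := by
    rw [aux_Qtwo, ← hx]
    have e := aux_exp (w 0 + w 1)
    rw [← hP] at e
    have e1 := aux_lin P x hP0
    have e2 := aux_lin P (w 4) hP0
    have e3 := aux_lin P (w 5) hP0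
    have f1 : 0 ≤ P * x ^ 2 := by positivity
    have f2 : 0 ≤ P * (w 4) ^ 2 := by positivity
    have f3 : 0 ≤ P * (w 5) ^ 2 := by positivity
    linarith
  have hB : |w 0 - w 1| + |w 2| ≤ 2 * R * Qone w + 4 * ((w 5) ^ 2 + 4) * R⁻¹ := by
    have e := aux_exp (w 0 - w 1)
    rw [← hR] at e
    have e1 := aux_lin R (w 2) hR0
    have f1 : 0 ≤ R * (w 2) ^ 2 := by positivity
    have f2 : 0 ≤ (w 5) ^ 2 * R⁻¹ := by positivity
    have f3 := mul_le_mul_of_nonneg_left (aux_Qone w) hR0.le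
    linarith
  have hC : |w 0| + |w 1| ≤ |w 0 + w 1| + |w 0 - w 1| := by
    have g1 := abs_add_le (w 0 + w 1) (w 0 - w 1)
    have g2 := abs_sub (w 0 + w 1) (w 0 - w 1)
    have g3 : w 0 + w 1 + (w 0 - w 1) = 2 * w 0 := by ring
    have g4 : w 0 + w 1 - (w 0 - w 1) = 2 * w 1 := by ring
    rw [g3, abs_mul, abs_two] at g1
    rw [g4, abs_mul, abs_two] at g2
    linarith
  have k1 := mul_le_mul h₁ hA (by positivity) (hc.le.trans h₁)
  have k2 := mul_le_mul h₂ hB (by positivity) (hc.le.trans h₂)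
  have k3 := mul_le_mul_of_nonneg_left hC hc.le
  rw [hE]
  linarith

/-- For Cartan temperatures with `λ − μ > 0` and `λ + μ > 0`, the Souriau partition function
of the Siegel half-plane `𝕊ℍ₂` converges: the Gibbs integrand `exp(E(w))` is Lebesgue
integrable on `ℝ⁶`. -/
theorem stmt_17 (l m : ℝ) (h₁ : 0 < l - m) (h₂ : 0 < l + m) :
    Integrable (fun w : EuclideanSpace ℝ (Fin 6) => Real.exp (siegelExp l m w)) volume := by
  obtain ⟨c, hc, hc1, hc2⟩ : ∃ c : ℝ, 0 < c ∧ c ≤ (l - m) / 64 ∧ c ≤ (l + m) / 64 :=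
    ⟨min ((l - m) / 64) ((l + m) / 64), lt_min (by positivity) (by positivity),
      min_le_left _ _, min_le_right _ _⟩
  have hprod : Integrable (fun v : Fin 6 → ℝ => ∏ i, Real.exp (-(c / 2) * Real.sqrt |v i|)) :=
    Integrable.fintype_prod (fun _ => aux_int (c / 2) (by positivity))
  have hprod' : Integrable (fun w : EuclideanSpace ℝ (Fin 6) =>
      ∏ i, Real.exp (-(c / 2) * Real.sqrt |w i|)) :=
    (PiLp.volume_preserving_ofLp (Fin 6)).integrable_comp_of_integrable hprod
  refine Integrable.mono' (hprod'.const_mul (Real.exp (3 * c))) ?_ ?_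
  · refine Continuous.aestronglyMeasurable ?_
    unfold siegelExp Qone Qtwo
    refine Real.continuous_exp.comp (Continuous.div (by fun_prop) (by fun_prop) ?_)
    intro w
    positivity
  · filter_upwards with w
    rw [Real.norm_eq_abs, abs_of_pos (Real.exp_pos _), ← Real.exp_sum, ← Real.exp_add]
    apply Real.exp_le_exp.2
    have hm := aux_main l m c hc hc1 hc2 w
    have hk : |Real.sqrt 2 / 4| ≤ 1 := by
      rw [abs_of_nonneg (by positivity)]
      have : Real.sqrt 2 ≤ 2 := Real.sqrt_le_iff.2 ⟨by norm_num, by norm_num⟩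
      linarith
    have s3 := aux_shear (Real.sqrt 2 / 4) (w 3) (w 4) (w 5) hk
    have s0 := aux_sqrt (w 0)
    have s1 := aux_sqrt (w 1)
    have s2 := aux_sqrt (w 2)
    have s4 := aux_sqrt (w 4)
    have s5 := aux_sqrt (w 5)
    rw [← Finset.mul_sum, Fin.sum_univ_six]
    have a0 := abs_nonneg (w 0)
    have a1 := abs_nonneg (w 1)
    have a2 := abs_nonneg (w 2)
    have a3 := abs_nonneg (w 3 - Real.sqrt 2 / 4 * w 4 * w 5)
    have hS : Real.sqrt |w 0| + Real.sqrt |w 1| + Real.sqrt |w 2| + Real.sqrt |w 3|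
        + Real.sqrt |w 4| + Real.sqrt |w 5| ≤ 2 * (|w 0| + |w 1| + |w 2|
          + |w 3 - Real.sqrt 2 / 4 * w 4 * w 5| + |w 4| + |w 5|) + 6 := by linarith
    have := mul_le_mul_of_nonneg_left hS (show 0 ≤ c / 2 by positivity)
    linarith
end
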